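/- arXiv:2403.04265 — 4 statements merged into one kernel-verified Lean document; each statement's English description precedes it below -/
import Mathlib

section
/- Let ι be a finite type, w : ι → ℕ a weight function, and η a natural number such that ∑_{i∈ι} w(i) = 2η. Then there exists a subset A ⊆ ι with ∑_{i∈A} w(i) = η if and only if there exists a function φ : ι → Fin 2 such that for every j ∈ Fin 2 we have η ≤ ∑_{i : φ(i)=j} w(i). (Correctness of the Partition reduction showing NP-hardness of complete conflict-free fair allocation for two agents.) -/
/-- Correctness of the `Partition` reduction: for weights `w` on a finite type `ι`
with total weight `2η`, there is a subset of total weight exactly `η` iff there is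
a complete allocation of the items to two agents giving each agent satisfaction at
least `η`. -/
theorem partition_reduction {ι : Type*} [Fintype ι] (w : ι → ℕ) (η : ℕ)
    (htot : ∑ i, w i = 2 * η) :
    (∃ A : Finset ι, ∑ i ∈ A, w i = η) ↔
      (∃ φ : ι → Fin 2, ∀ j : Fin 2,
        η ≤ ∑ i ∈ Finset.univ.filter (fun i => φ i = j), w i) := by
  classical
  have hsplit (φ : ι → Fin 2) :
      ∑ i with φ i = 0, w i + ∑ i with φ i = 1, w i = 2 * η := by
    rw [← htot, ← Finset.sum_fiberwise Finset.univ φ w, Fin.sum_univ_two]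
  constructor
  · rintro ⟨A, hA⟩
    let φ : ι → Fin 2 := fun i => if i ∈ A then 0 else 1
    have hzero : ∑ i with φ i = 0, w i = η := by
      rw [← hA]
      congr 1
      ext i
      simp [φ]
    have := hsplit φ
    refine ⟨φ, Fin.forall_fin_two.2 ⟨?_, ?_⟩⟩ <;> omega
  · rintro ⟨φ, hφ⟩
    refine ⟨Finset.univ.filter (fun i => φ i = 0), ?_⟩
    have := hsplit φ
    have := hφ 0
    have := hφ 1
    omega
end

section
/- Let G be a simple graph on the linearly ordered finite vertex set Fin N, and let D be a natural number such that every vertex v has at most D neighbors u with v < u. Then the number of nonempty finite vertex sets S that are cliques of G is at most N·2^D. -/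
/-- If every vertex of a simple graph `G` on the linearly ordered vertex set `Fin N`
has at most `D` forward neighbors (neighbors larger than itself), then `G` has at
most `N·2^D` nonempty cliques. -/
theorem card_cliques_le_of_forward_degree {N : ℕ} (G : SimpleGraph (Fin N))
    [DecidableRel G.Adj] (D : ℕ)
    (h : ∀ v : Fin N, ((G.neighborFinset v).filter (fun u => v < u)).card ≤ D) :
    Nat.card {S : Finset (Fin N) // S.Nonempty ∧ G.IsClique (S : Set (Fin N))} ≤
      N * 2 ^ D := by
  classical
  let forward (v : Fin N) := (G.neighborFinset v).filter (fun u => v < u)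
  let candidates := Finset.univ.biUnion fun v => (forward v).powerset.image (insert v)
  have hcard : candidates.card ≤ N * 2 ^ D := by
    have hbound := Finset.card_biUnion_le_card_mul Finset.univ
      (fun v => (forward v).powerset.image (insert v)) (2 ^ D) fun v _ =>
        Finset.card_image_le.trans <| by
          rw [Finset.card_powerset]
          exact Nat.pow_le_pow_right two_pos (h v)
    simpa using hbound
  rw [Nat.card_eq_fintype_card, Fintype.card_subtype]
  refine (Finset.card_le_card fun S hS => ?_).trans hcard
  obtain ⟨hne, hclique⟩ := (Finset.mem_filter.mp hS).2
  have hmin := S.min'_mem hne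
  refine Finset.mem_biUnion.mpr ⟨S.min' hne, Finset.mem_univ _, Finset.mem_image.mpr
    ⟨S.erase (S.min' hne), Finset.mem_powerset.mpr fun u hu => ?_, Finset.insert_erase hmin⟩⟩
  have hlt := S.min'_lt_of_mem_erase_min' hne hu
  exact Finset.mem_filter.mpr ⟨(G.mem_neighborFinset _ _).mpr
    (hclique hmin (Finset.mem_of_mem_erase hu) hlt.ne), hlt⟩
end

section
/- Every simple graph on a finite vertex type with at most t edges has at most 2t·2^{2⌊√t⌋} cliques of size at least 2, where ⌊√t⌋ denotes the natural-number square root of t. (The clique-counting bound underlying the subexponential algorithm of Theorem 4.) -/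
namespace SimpleGraph

variable {V : Type*} [Fintype V] (G : SimpleGraph V) [DecidableRel G.Adj]

/-- The neighbours of `v` whose degree is at least that of `v`. -/
def upNeighborFinset (v : V) : Finset V :=
  (G.neighborFinset v).filter fun w => G.degree v ≤ G.degree w

theorem card_upNeighborFinset_mul_succ_le [DecidableEq V] (v : V) :
    (G.upNeighborFinset v).card * ((G.upNeighborFinset v).card + 1) ≤ 2 * G.edgeFinset.card := by
  have hv : v ∉ G.upNeighborFinset v := by simp [upNeighborFinset]
  have hd : (G.upNeighborFinset v).card ≤ G.degree v := by
    rw [← G.card_neighborFinset_eq_degree]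
    exact Finset.card_filter_le _ _
  rw [← G.sum_degrees_eq_twice_card_edges, ← Finset.card_insert_of_notMem hv, mul_comm]
  calc (insert v (G.upNeighborFinset v)).card * (G.upNeighborFinset v).card
      ≤ ∑ w ∈ insert v (G.upNeighborFinset v), G.degree w := by
        rw [← smul_eq_mul]
        refine Finset.card_nsmul_le_sum _ _ _ fun w hw => ?_
        rcases Finset.mem_insert.mp hw with rfl | hw
        · exact hd
        · exact hd.trans (Finset.mem_filter.mp hw).2
    _ ≤ ∑ w, G.degree w := Finset.sum_le_univ_sum_of_nonneg fun _ => Nat.zero_le _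

theorem card_upNeighborFinset_le_two_mul_sqrt [DecidableEq V] {t : ℕ}
    (hE : G.edgeFinset.card ≤ t) (v : V) :
    (G.upNeighborFinset v).card ≤ 2 * Nat.sqrt t := by
  have h := G.card_upNeighborFinset_mul_succ_le v
  have ht := Nat.sqrt_le_add t
  by_contra! hlt
  nlinarith

theorem card_filter_degree_pos_le [DecidableEq V] :
    (Finset.univ.filter fun v => 0 < G.degree v).card ≤ 2 * G.edgeFinset.card := by
  rw [← G.sum_degrees_eq_twice_card_edges, Finset.card_filter]
  refine Finset.sum_le_sum fun v _ => ?_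
  split_ifs with h
  · exact h
  · exact Nat.zero_le _

variable {G} in
theorem IsClique.exists_erase_subset_upNeighborFinset [DecidableEq V] {S : Finset V}
    (hS : G.IsClique (S : Set V)) (hne : S.Nonempty) :
    ∃ v ∈ S, S.erase v ⊆ G.upNeighborFinset v := by
  obtain ⟨v, hv, hmin⟩ := S.exists_min_image (fun w => G.degree w) hne
  refine ⟨v, hv, fun w hw => ?_⟩
  obtain ⟨hwv, hwS⟩ := Finset.mem_erase.mp hw
  simpa [upNeighborFinset] using ⟨hS hv hwS hwv.symm, hmin w hwS⟩

variable {G} in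
theorem IsClique.degree_pos {S : Finset V} (hS : G.IsClique (S : Set V))
    (hcard : 2 ≤ S.card) {v : V} (hv : v ∈ S) : 0 < G.degree v := by
  obtain ⟨w, hw, hwv⟩ := Finset.exists_mem_ne hcard v
  exact (G.degree_pos_iff_exists_adj v).mpr ⟨w, hS hv hw hwv.symm⟩

end SimpleGraph

/-- Every simple graph on a finite vertex type with at most `t` edges has at most
`2t·2^{2⌊√t⌋}` cliques of size at least `2`. -/
theorem card_big_cliques_le {V : Type*} [Fintype V] [DecidableEq V]
    (G : SimpleGraph V) [DecidableRel G.Adj] (t : ℕ)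
    (hE : G.edgeFinset.card ≤ t) :
    Nat.card {S : Finset V // 2 ≤ S.card ∧ G.IsClique (S : Set V)} ≤
      2 * t * 2 ^ (2 * Nat.sqrt t) := by
  classical
  rw [Nat.card_eq_fintype_card, Fintype.card_subtype]
  have hsub : (Finset.univ.filter fun S : Finset V => 2 ≤ S.card ∧ G.IsClique (S : Set V)) ⊆
      (Finset.univ.filter fun v => 0 < G.degree v).biUnion fun v =>
        (G.upNeighborFinset v).powerset.image (insert v) := by
    intro S hS
    obtain ⟨hcard, hclique⟩ := (Finset.mem_filter.mp hS).2
    obtain ⟨v, hv, hup⟩ := hclique.exists_erase_subset_upNeighborFinset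
      (Finset.card_pos.mp (by lia))
    exact Finset.mem_biUnion.mpr ⟨v, by simpa using hclique.degree_pos hcard hv,
      Finset.mem_image.mpr ⟨S.erase v, Finset.mem_powerset.mpr hup, Finset.insert_erase hv⟩⟩
  refine (Finset.card_le_card hsub).trans ((Finset.card_biUnion_le_card_mul _ _
    (2 ^ (2 * Nat.sqrt t)) fun v _ => ?_).trans ?_)
  · refine Finset.card_image_le.trans ?_
    rw [Finset.card_powerset]
    exact Nat.pow_le_pow_right two_pos (G.card_upNeighborFinset_le_two_mul_sqrt hE v)
  · exact Nat.mul_le_mul_right _ (G.card_filter_degree_pos_le.trans (by lia))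
end

section
/- Let I be a finite type, let X ⊆ I be a subset with complement Y = I∖X, let u : I → ℕ be a utility function, and let η ≥ 1 and n be natural numbers. Let H = {z ∈ I : η ≤ u(z)} and k = n − min(n, |H|). Then the following are equivalent: (i) there exist pairwise disjoint finite sets S_1, …, S_n ⊆ I such that for every i, |S_i ∩ X| ≤ 1, |S_i ∩ Y| ≤ 1, and η ≤ ∑_{x∈S_i} u(x); (ii) there exist elements a_1, …, a_k ∈ X∖H and b_1, …, b_k ∈ Y∖H, all 2k of them pairwise distinct, such that η ≤ u(a_j) + u(b_j) for every j ∈ {1,…,k}. (Correctness of the polynomial-time matching algorithm for conflict graphs that are a union of two cliques with uniform utilities, Theorem 7(1).) -/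
/-- A bundle with at most one item on each side, all of whose items have utility below `η`,
reaches utility `η` only through a pair of items, one from each side. -/
lemma exists_pair_of_le_sum {I : Type*} [Fintype I] [DecidableEq I]
    {X S : Finset I} {u : I → ℕ} {η : ℕ} (hX : (S ∩ X).card ≤ 1) (hY : (S ∩ Xᶜ).card ≤ 1)
    (hη : 1 ≤ η) (hsum : η ≤ ∑ x ∈ S, u x) (hlow : ∀ x ∈ S, u x < η) :
    ∃ a ∈ S ∩ X, ∃ b ∈ S ∩ Xᶜ, η ≤ u a + u b := by
  have hsplit : ∑ x ∈ S, u x = ∑ x ∈ S ∩ X, u x + ∑ x ∈ S ∩ Xᶜ, u x := by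
    rw [← Finset.sdiff_eq_inter_compl, ← Finset.sum_union (Finset.disjoint_sdiff_inter S X).symm,
      Finset.union_comm, Finset.sdiff_union_inter]
  rw [hsplit] at hsum
  rw [Nat.le_one_iff_eq_zero_or_eq_one, Finset.card_eq_zero, Finset.card_eq_one] at hX hY
  obtain ha | ⟨a, ha⟩ := hX <;> obtain hb | ⟨b, hb⟩ := hY <;>
  simp only [ha, hb, Finset.sum_empty, Finset.sum_singleton] at hsum
  · omega
  · have hbS : b ∈ S := Finset.inter_subset_left (hb ▸ Finset.mem_singleton_self b)
    have := hlow b hbS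
    omega
  · have haS : a ∈ S := Finset.inter_subset_left (ha ▸ Finset.mem_singleton_self a)
    have := hlow a haS
    omega
  · exact ⟨a, by simp [ha], b, by simp [hb], hsum⟩

/-- Among `n` pairwise disjoint sets, at least `n - min n |H|` avoid a given set `H`. -/
lemma sub_min_card_le_card_filter_disjoint {I : Type*} [DecidableEq I] {n : ℕ}
    (S : Fin n → Finset I) (hS : ∀ i j, i ≠ j → Disjoint (S i) (S j)) (H : Finset I) :
    n - min n H.card ≤ (Finset.univ.filter fun i => Disjoint (S i) H).card := by
  have hmeet : (Finset.univ.filter fun i => ¬ Disjoint (S i) H).card ≤ H.card := by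
    refine Finset.card_le_card_of_forall_subsingleton (fun i x => x ∈ S i) ?_ ?_
    · intro i hi
      obtain ⟨x, hxS, hxH⟩ := Finset.not_disjoint_iff.mp (Finset.mem_filter.mp hi).2
      exact ⟨x, hxH, hxS⟩
    · rintro x - i ⟨-, hi⟩ j ⟨-, hj⟩
      by_contra hne
      exact Finset.disjoint_left.mp (hS i j hne) hi hj
  have hcard := Finset.card_filter_add_card_filter_not (s := (Finset.univ : Finset (Fin n)))
    (fun i => Disjoint (S i) H)
  rw [Finset.card_univ, Fintype.card_fin] at hcard
  omega

/-- Correctness of the polynomial-time matching algorithm for conflict graphs that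
are the union of two cliques (on `X` and its complement `Y`) with uniform utilities:
with `H` the set of items of utility at least `η` and `k = n − min(n, |H|)`, there is
a feasible allocation of pairwise disjoint conflict-free bundles of utility at least
`η` to `n` agents iff there are `k` pairs of distinct low-utility items, one from each
side, each pair having total utility at least `η`. -/
theorem two_cliques_matching_correctness {I : Type*} [Fintype I] [DecidableEq I]
    (X : Finset I) (u : I → ℕ) (η n : ℕ) (hη : 1 ≤ η) :
    (∃ S : Fin n → Finset I,
        (∀ i j : Fin n, i ≠ j → Disjoint (S i) (S j)) ∧
        (∀ i : Fin n, (S i ∩ X).card ≤ 1 ∧ (S i ∩ Xᶜ).card ≤ 1 ∧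
          η ≤ ∑ x ∈ S i, u x)) ↔
      (∃ a b : Fin (n - min n (Finset.univ.filter (fun z : I => η ≤ u z)).card) → I,
        Function.Injective a ∧ Function.Injective b ∧
        (∀ j j', a j ≠ b j') ∧
        (∀ j, a j ∈ X \ Finset.univ.filter (fun z : I => η ≤ u z)) ∧
        (∀ j, b j ∈ Xᶜ \ Finset.univ.filter (fun z : I => η ≤ u z)) ∧
        (∀ j, η ≤ u (a j) + u (b j))) := by
  set H := Finset.univ.filter (fun z : I => η ≤ u z) with hH
  have memH : ∀ z, z ∈ H ↔ η ≤ u z := fun z => by simp [hH]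
  constructor
  · rintro ⟨S, hS, hb⟩
    have hle : Fintype.card (Fin (n - min n H.card)) ≤
        Fintype.card {i // Disjoint (S i) H} := by
      rw [Fintype.card_fin, Fintype.card_subtype]
      exact sub_min_card_le_card_filter_disjoint S hS H
    obtain ⟨e⟩ := Function.Embedding.nonempty_of_card_le hle
    have hpair : ∀ j, ∃ a ∈ S (e j) ∩ X, ∃ b ∈ S (e j) ∩ Xᶜ, η ≤ u a + u b := fun j =>
      exists_pair_of_le_sum (hb _).1 (hb _).2.1 hη (hb _).2.2 fun x hx =>
        not_le.mp fun h => Finset.disjoint_left.mp (e j).2 hx ((memH x).mpr h)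
    choose a ha b hb' hab using hpair
    have hinj : ∀ c : Fin (n - min n H.card) → I, (∀ j, c j ∈ S (e j)) →
        Function.Injective c := by
      intro c hc i j hij
      by_contra hne
      refine Finset.disjoint_left.mp (hS (e i) (e j) ?_) (hc i) (hij ▸ hc j)
      exact fun h => hne (e.injective (Subtype.ext h))
    simp only [Finset.mem_inter, Finset.mem_compl] at ha hb'
    refine ⟨a, b, hinj a fun j => (ha j).1, hinj b fun j => (hb' j).1,
      fun j j' h => (hb' j').2 (h ▸ (ha j).2), fun j => ?_, fun j => ?_, hab⟩
    · exact Finset.mem_sdiff.mpr ⟨(ha j).2, Finset.disjoint_left.mp (e j).2 (ha j).1⟩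
    · exact Finset.mem_sdiff.mpr ⟨Finset.mem_compl.mpr (hb' j).2,
        Finset.disjoint_left.mp (e j).2 (hb' j).1⟩
  · rintro ⟨a, b, hainj, hbinj, hne, ha, hb, hab⟩
    have hle : Fintype.card (Fin (min n H.card)) ≤ Fintype.card H := by simp
    obtain ⟨g⟩ := Function.Embedding.nonempty_of_card_le hle
    let e : Fin n ≃ Fin (min n H.card) ⊕ Fin (n - min n H.card) :=
      (finCongr (by omega)).trans finSumFinEquiv.symm
    let T : Fin (min n H.card) ⊕ Fin (n - min n H.card) → Finset I :=
      Sum.elim (fun i => {(g i : I)}) (fun j => {a j, b j})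
    simp only [Finset.mem_sdiff, Finset.mem_compl] at ha hb
    have hga : ∀ i j, (g i : I) ≠ a j := fun i j h => (ha j).2 (h ▸ (g i).2)
    have hgb : ∀ i j, (g i : I) ≠ b j := fun i j h => (hb j).2 (h ▸ (g i).2)
    have hT : ∀ p q, p ≠ q → Disjoint (T p) (T q) := by
      rintro (i | i) (j | j) hpq
      · have : i ≠ j := fun h => hpq (h ▸ rfl)
        simpa [T, Subtype.ext_iff] using fun h => this (g.injective (Subtype.ext h))
      · simp [T, hga, hgb]
      · simp [T, hga, hgb]
      · have hij : i ≠ j := fun h => hpq (h ▸ rfl)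
        simp [T, hainj.ne hij.symm, hbinj.ne hij.symm, hne, (hne _ _).symm]
    have hT' : ∀ p, (T p ∩ X).card ≤ 1 ∧ (T p ∩ Xᶜ).card ≤ 1 ∧ η ≤ ∑ x ∈ T p, u x := by
      rintro (i | j)
      · refine ⟨(Finset.card_le_card Finset.inter_subset_left).trans (by simp [T]),
          (Finset.card_le_card Finset.inter_subset_left).trans (by simp [T]), ?_⟩
        simpa [T] using (memH _).mp (g i).2
      · refine ⟨?_, ?_, ?_⟩
        · simp [T, Finset.insert_inter_of_mem (ha j).1, Finset.singleton_inter_of_notMem (hb j).1]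
        · simp [T, Finset.insert_inter_of_notMem, (ha j).1,
            Finset.singleton_inter_of_mem, (hb j).1]
        · simpa [T, Finset.sum_pair (hne j j)] using hab j
    exact ⟨fun i => T (e i), fun i j hij => hT _ _ (e.injective.ne hij), fun i => hT' _⟩
end
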